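/- Fix a temperature τ > 0 and a data density p with p(x) > 0 for all x and p·log p integrable. Let Π be a set of densities containing p, each π ∈ Π having π·log π and π·log p integrable, and let S be a set of measurable functions E : ℝ^d → ℝ, each with p·E integrable and π·E integrable for every π ∈ Π, such that E^p(x) = −τ·log p(x) + c belongs to S for some constant c ∈ ℝ. Then strong duality (minimax equality) holds for the GCD objective: sup_{π∈Π} inf_{E∈S} Φ(E, π) = inf_{E∈S} sup_{π∈Π} Φ(E, π) = τ·H(p). -/

import Mathlib

open MeasureTheory

/-- A density on `ℝ^d`: measurable, a.e. nonnegative, integrating to one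
(w.r.t. Lebesgue measure). -/
def IsDensity {d : ℕ} (ρ : (Fin d → ℝ) → ℝ) : Prop :=
  Measurable ρ ∧ (∀ᵐ x, 0 ≤ ρ x) ∧ Integrable ρ ∧ (∫ x, ρ x) = 1

/-- Differential entropy `H(ρ) = −∫ ρ log ρ` (with `0·log 0 = 0`). -/
noncomputable def H {d : ℕ} (ρ : (Fin d → ℝ) → ℝ) : ℝ :=
  -∫ x, ρ x * Real.log (ρ x)

/-- KL divergence `KL(ρ‖σ) = ∫ ρ log(ρ/σ)` (with `0·log 0 = 0`). -/
noncomputable def KL {d : ℕ} (ρ σ : (Fin d → ℝ) → ℝ) : ℝ :=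
  ∫ x, ρ x * Real.log (ρ x / σ x)

/-- The GCD objective `Φ(E, π) = ∫ p E − ∫ π E + τ H(π)`. -/
noncomputable def Phi {d : ℕ} (τ : ℝ) (p E π : (Fin d → ℝ) → ℝ) : ℝ :=
  (∫ x, p x * E x) - (∫ x, π x * E x) + τ * H π

theorem gibbs_aux {d : ℕ} (p q : (Fin d → ℝ) → ℝ) (hp : IsDensity p) (hq : IsDensity q)
    (hppos : ∀ x, 0 < p x)
    (h1 : Integrable (fun x => q x * Real.log (q x)))
    (h2 : Integrable (fun x => q x * Real.log (p x))) :
    (∫ x, q x * Real.log (p x)) ≤ ∫ x, q x * Real.log (q x) := by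
  obtain ⟨-, -, hpi, hp1⟩ := hp
  obtain ⟨-, hq0, hqi, hq1⟩ := hq
  have key : (∫ x, (q x * Real.log (p x) - q x * Real.log (q x))) ≤ ∫ x, (p x - q x) := by
    refine integral_mono_ae (h2.sub h1) (hpi.sub hqi) ?_
    filter_upwards [hq0] with x hx
    rcases hx.eq_or_lt with h | h
    · simp [← h, (hppos x).le]
    · have := Real.log_le_sub_one_of_pos (div_pos (hppos x) h)
      rw [Real.log_div (hppos x).ne' h.ne'] at this
      have h3 := mul_le_mul_of_nonneg_left this hx
      have h4 : q x * (p x / q x - 1) = p x - q x := by field_simp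
      linarith
  rw [integral_sub h2 h1, integral_sub hpi hqi] at key
  linarith

/-- strong duality (minimax equality) holds for the GCD objective:
`sup_{π∈Π} inf_{E∈S} Φ(E, π) = inf_{E∈S} sup_{π∈Π} Φ(E, π) = τ H(p)`. -/
theorem gcd_energy_strong_duality {d : ℕ} (τ : ℝ) (hτ : 0 < τ)
    (p : (Fin d → ℝ) → ℝ) (hp : IsDensity p) (hppos : ∀ x, 0 < p x)
    (hplogp : Integrable (fun x => p x * Real.log (p x)))
    (Pi : Set ((Fin d → ℝ) → ℝ)) (hpPi : p ∈ Pi)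
    (hPi : ∀ π ∈ Pi, IsDensity π ∧ Integrable (fun x => π x * Real.log (π x)) ∧
        Integrable (fun x => π x * Real.log (p x)))
    (S : Set ((Fin d → ℝ) → ℝ)) (hSmeas : ∀ E ∈ S, Measurable E)
    (hSint : ∀ E ∈ S, Integrable (fun x => p x * E x) ∧
        ∀ π ∈ Pi, Integrable (fun x => π x * E x))
    (c : ℝ) (hEpS : (fun x => -τ * Real.log (p x) + c) ∈ S) :
    (⨆ π ∈ Pi, ⨅ E ∈ S, ((Phi τ p E π : ℝ) : EReal))
        = (⨅ E ∈ S, ⨆ π ∈ Pi, ((Phi τ p E π : ℝ) : EReal)) ∧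
    (⨅ E ∈ S, ⨆ π ∈ Pi, ((Phi τ p E π : ℝ) : EReal)) = ((τ * H p : ℝ) : EReal) := by
  have hEp : ∀ π ∈ Pi, (∫ x, π x * (-τ * Real.log (p x) + c))
      = -τ * (∫ x, π x * Real.log (p x)) + c := by
    intro π hπ
    obtain ⟨⟨-, -, hi, h1⟩, -, h2⟩ := hPi π hπ
    have : (fun x => π x * (-τ * Real.log (p x) + c))
        = fun x => -τ * (π x * Real.log (p x)) + c * π x := by
      funext x; ring
    rw [this, integral_add (h2.const_mul _) (hi.const_mul _), integral_const_mul,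
      integral_const_mul, h1, mul_one]
  have hlow : ((τ * H p : ℝ) : EReal) ≤ ⨆ π ∈ Pi, ⨅ E ∈ S, ((Phi τ p E π : ℝ) : EReal) := by
    refine le_iSup₂_of_le p hpPi (le_iInf₂ fun E _ => ?_)
    simp [Phi]
  have hup : (⨅ E ∈ S, ⨆ π ∈ Pi, ((Phi τ p E π : ℝ) : EReal)) ≤ ((τ * H p : ℝ) : EReal) := by
    refine iInf₂_le_of_le _ hEpS (iSup₂_le fun π hπ => ?_)
    rw [EReal.coe_le_coe_iff]
    have hg := gibbs_aux p π hp (hPi π hπ).1 hppos (hPi π hπ).2.1 (hPi π hπ).2.2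
    simp only [Phi, H]
    rw [hEp π hπ, hEp p hpPi]
    nlinarith [mul_le_mul_of_nonneg_left hg hτ.le]
  have hweak : (⨆ π ∈ Pi, ⨅ E ∈ S, ((Phi τ p E π : ℝ) : EReal))
      ≤ ⨅ E ∈ S, ⨆ π ∈ Pi, ((Phi τ p E π : ℝ) : EReal) :=
    iSup₂_le fun π hπ => le_iInf₂ fun E hE =>
      iInf₂_le_of_le E hE (le_iSup₂_of_le π hπ le_rfl)
  exact ⟨le_antisymm hweak (hup.trans hlow), le_antisymm hup (hlow.trans hweak)⟩
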